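/- arXiv:0802.3039 — 2 statements merged into one kernel-verified Lean document; each statement's English description precedes it below -/
import Mathlib

section
/- Let γ = 0 (the Vasicek model) and β ≠ 0. Then q(r) ≡ 0, so that ln P^{ap}(τ,r) = −rB(τ) + (α/β)(τ−B(τ)) + (σ²/(4β))[B(τ)² + (2/β)(τ−B(τ))], and the function P^{ap}(τ,r) = exp(ln P^{ap}(τ,r)) satisfies exactly the bond pricing PDE with γ = 0, namely −∂_τP^{ap} + (1/2)σ²∂²_rP^{ap} + (α+βr)∂_rP^{ap} − rP^{ap} = 0 for all r > 0 and τ > 0, together with the initial condition P^{ap}(0,r) = 1 for all r. -/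
open Set MeasureTheory Real Filter Topology Asymptotics

noncomputable section

/-- Partial derivative of `P = P(τ,r)` with respect to `τ`. -/
def pTau (P : ℝ → ℝ → ℝ) (τ r : ℝ) : ℝ := deriv (fun t => P t r) τ

/-- Partial derivative of `P = P(τ,r)` with respect to `r`. -/
def pR (P : ℝ → ℝ → ℝ) (τ r : ℝ) : ℝ := deriv (fun x => P τ x) r

/-- Second partial derivative of `P = P(τ,r)` with respect to `r`. -/
def pRR (P : ℝ → ℝ → ℝ) (τ r : ℝ) : ℝ := deriv (fun x => pR P τ x) r

/-- A complete solution of the bond pricing PDE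
`-∂_τ P + (1/2) σ² r^{2γ} ∂²_r P + (α + β r) ∂_r P - r P = 0`
on `r > 0`, `τ ∈ (0,T)`, with initial condition `P(0,r) = 1`, continuous partial
derivatives on `[0,∞) × (0,T)` and the growth conditions
`|P(τ,r)| ≤ M e^{-m r^δ}`, `|∂_r P(τ,r)| ≤ M`. -/
structure IsCompleteSolution (σ α β γ T : ℝ) (P : ℝ → ℝ → ℝ) : Prop where
  diff_tau : ∀ τ ∈ Ioo (0:ℝ) T, ∀ r ∈ Ici (0:ℝ), DifferentiableAt ℝ (fun t => P t r) τ
  diff_r : ∀ τ ∈ Ioo (0:ℝ) T, ∀ r ∈ Ici (0:ℝ), DifferentiableAt ℝ (fun x => P τ x) r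
  diff_rr : ∀ τ ∈ Ioo (0:ℝ) T, ∀ r ∈ Ici (0:ℝ), DifferentiableAt ℝ (fun x => pR P τ x) r
  cont_tau : ContinuousOn (fun p : ℝ × ℝ => pTau P p.1 p.2) (Ioo 0 T ×ˢ Ici 0)
  cont_r : ContinuousOn (fun p : ℝ × ℝ => pR P p.1 p.2) (Ioo 0 T ×ˢ Ici 0)
  cont_rr : ContinuousOn (fun p : ℝ × ℝ => pRR P p.1 p.2) (Ioo 0 T ×ˢ Ici 0)
  pde : ∀ τ ∈ Ioo (0:ℝ) T, ∀ r : ℝ, 0 < r →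
      -pTau P τ r + (1/2) * σ^2 * r ^ (2*γ) * pRR P τ r
        + (α + β * r) * pR P τ r - r * P τ r = 0
  init : ∀ r : ℝ, 0 ≤ r → P 0 r = 1
  growth : ∃ M m δ : ℝ, 0 < M ∧ 0 < m ∧ 0 < δ ∧
      ∀ τ ∈ Ioo (0:ℝ) T, ∀ r : ℝ, 0 < r →
        |P τ r| ≤ M * Real.exp (-m * r ^ δ) ∧ |pR P τ r| ≤ M

/-- `B(τ) = (e^{βτ} - 1)/β`. -/
def Bfun (β τ : ℝ) : ℝ := (Real.exp (β * τ) - 1) / β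

/-- `q(r) = γ(2γ-1)σ² r^{2(2γ-1)} + 2γ r^{2γ-1}(α + βr)`. -/
def qfun (σ α β γ r : ℝ) : ℝ :=
  γ * (2*γ - 1) * σ^2 * r ^ (2*(2*γ - 1)) + 2*γ * r ^ (2*γ - 1) * (α + β * r)

/-- Logarithm of the Choi–Wirjanto approximation of the bond price. -/
def lnPap (σ α β γ τ r : ℝ) : ℝ :=
  -r * Bfun β τ + (α/β) * (τ - Bfun β τ)
    + (r ^ (2*γ) + qfun σ α β γ r * τ) * (σ^2/(4*β)) *
        ((Bfun β τ)^2 + (2/β) * (τ - Bfun β τ))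
    - qfun σ α β γ r * (σ^2/(8*β^2)) *
        ((Bfun β τ)^2 * (2*β*τ - 1) - 2 * Bfun β τ * (2*τ - 3/β) + 2*τ^2 - 6*τ/β)

theorem qfun_gamma_zero (σ α β r : ℝ) : qfun σ α β 0 r = 0 := by
  simp [qfun]

theorem lnPap_gamma_zero (σ α β τ r : ℝ) : lnPap σ α β 0 τ r =
    -r * Bfun β τ + (α/β) * (τ - Bfun β τ)
      + (σ^2/(4*β)) * ((Bfun β τ)^2 + (2/β) * (τ - Bfun β τ)) := by
  simp [lnPap, qfun_gamma_zero]

theorem Bfun_zero (β : ℝ) : Bfun β 0 = 0 := by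
  simp [Bfun]

theorem hasDerivAt_Bfun {β : ℝ} (hβ : β ≠ 0) (τ : ℝ) :
    HasDerivAt (Bfun β) (1 + β * Bfun β τ) τ := by
  have h := ((((hasDerivAt_id τ).const_mul β).exp).sub_const 1).div_const β
  refine h.congr_deriv ?_
  simp only [Bfun, id_eq]
  field_simp
  ring

theorem hasDerivAt_lnPap_tau (σ α : ℝ) {β : ℝ} (hβ : β ≠ 0) (τ r : ℝ) :
    HasDerivAt (fun t => lnPap σ α β 0 t r)
      (-r * (1 + β * Bfun β τ) - α * Bfun β τ + σ^2 / 2 * (Bfun β τ)^2) τ := by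
  simp only [lnPap_gamma_zero]
  have hB := hasDerivAt_Bfun hβ τ
  have hsub := (hasDerivAt_id τ).sub hB
  refine (((hB.const_mul (-r)).add (hsub.const_mul (α/β))).add
    (((hB.pow 2).add (hsub.const_mul (2/β))).const_mul (σ^2/(4*β)))).congr_deriv ?_
  field_simp
  ring

theorem hasDerivAt_lnPap_r (σ α β τ r : ℝ) :
    HasDerivAt (fun x => lnPap σ α β 0 τ x) (-Bfun β τ) r := by
  simp only [lnPap_gamma_zero]
  refine ((((hasDerivAt_id r).neg.mul_const (Bfun β τ)).add_const _).add_const _).congr_deriv ?_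
  ring

theorem pTau_exp_lnPap (σ α : ℝ) {β : ℝ} (hβ : β ≠ 0) (τ r : ℝ) :
    pTau (fun t x => Real.exp (lnPap σ α β 0 t x)) τ r =
      Real.exp (lnPap σ α β 0 τ r) *
        (-r * (1 + β * Bfun β τ) - α * Bfun β τ + σ^2 / 2 * (Bfun β τ)^2) :=
  (hasDerivAt_lnPap_tau σ α hβ τ r).exp.deriv

theorem pR_exp_lnPap (σ α β τ r : ℝ) :
    pR (fun t x => Real.exp (lnPap σ α β 0 t x)) τ r =
      Real.exp (lnPap σ α β 0 τ r) * -Bfun β τ :=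
  (hasDerivAt_lnPap_r σ α β τ r).exp.deriv

theorem pRR_exp_lnPap (σ α β τ r : ℝ) :
    pRR (fun t x => Real.exp (lnPap σ α β 0 t x)) τ r =
      Real.exp (lnPap σ α β 0 τ r) * -Bfun β τ * -Bfun β τ := by
  simp only [pRR, pR_exp_lnPap]
  exact ((hasDerivAt_lnPap_r σ α β τ r).exp.mul_const (-Bfun β τ)).deriv

/-- in the Vasicek model (`γ = 0`, `β ≠ 0`) one has `q ≡ 0`, the
approximation formula simplifies accordingly, and `P^{ap}(τ,r) = exp(ln P^{ap}(τ,r))`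
satisfies the bond pricing PDE with `γ = 0` exactly, together with the initial
condition `P^{ap}(0,r) = 1`. -/
theorem vasicek_exact (σ α β : ℝ) (hσ : 0 < σ) (hα : 0 < α) (hβ : β ≠ 0) :
    (∀ r : ℝ, qfun σ α β 0 r = 0) ∧
    (∀ τ r : ℝ, lnPap σ α β 0 τ r =
      -r * Bfun β τ + (α/β) * (τ - Bfun β τ)
        + (σ^2/(4*β)) * ((Bfun β τ)^2 + (2/β) * (τ - Bfun β τ))) ∧
    (∀ r : ℝ, 0 < r → ∀ τ : ℝ, 0 < τ →
      -pTau (fun t x => Real.exp (lnPap σ α β 0 t x)) τ r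
        + (1/2) * σ^2 * pRR (fun t x => Real.exp (lnPap σ α β 0 t x)) τ r
        + (α + β*r) * pR (fun t x => Real.exp (lnPap σ α β 0 t x)) τ r
        - r * Real.exp (lnPap σ α β 0 τ r) = 0) ∧
    (∀ r : ℝ, Real.exp (lnPap σ α β 0 0 r) = 1) := by
  refine ⟨qfun_gamma_zero σ α β, lnPap_gamma_zero σ α β, fun r _ τ _ => ?_, fun r => ?_⟩
  · rw [pTau_exp_lnPap σ α hβ, pRR_exp_lnPap, pR_exp_lnPap]
    ring
  · simp [lnPap_gamma_zero, Bfun_zero]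
end
end

section
/- Let γ = 1/2 and assume 2α > σ². Set ω = 2α/σ² − 1 > 0 and let P be a complete solution of the bond pricing PDE. Then for all τ ∈ (0,T), (d/dτ) ∫₀^∞ r^ω P(τ,r)² dr ≤ K ∫₀^∞ r^ω P(τ,r)² dr with K = −(ω+1)β. -/
open Set MeasureTheory Real Filter Topology Asymptotics

noncomputable section

theorem exists_rpow_mul_exp_neg_mul_rpow_le {m δ q : ℝ} (hm : 0 < m) (hδ : 0 < δ) (hq : 0 ≤ q) :
    ∃ C : ℝ, 0 < C ∧ ∀ r : ℝ, 0 < r → r ^ q * exp (-m * r ^ δ) ≤ C * (1 + r ^ 2)⁻¹ := by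
  obtain ⟨k, hk⟩ := exists_nat_ge ((q + 2) / δ)
  have hkδ : q + 2 ≤ δ * k := by
    rw [div_le_iff₀ hδ] at hk
    linarith
  have hf : (0 : ℝ) < k.factorial := by exact_mod_cast k.factorial_pos
  refine ⟨2 + 2 * (k.factorial / m ^ k), by positivity, fun r hr => ?_⟩
  rw [← div_eq_mul_inv, le_div_iff₀ (by positivity)]
  have hexp : exp (-m * r ^ δ) ≤ 1 := by
    rw [exp_le_one_iff, neg_mul]
    exact neg_nonpos.2 (by positivity)
  have hpos : 0 < (k.factorial : ℝ) / m ^ k := by positivity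
  rcases le_total r 1 with h1 | h1
  · have h2 : r ^ q ≤ 1 := rpow_le_one hr.le h1 hq
    have h3 : r ^ q * exp (-m * r ^ δ) ≤ 1 := mul_le_one₀ h2 (exp_pos _).le hexp
    have h4 : r ^ q * exp (-m * r ^ δ) * (1 + r ^ 2) ≤ 1 * 2 :=
      mul_le_mul h3 (by nlinarith) (by positivity) zero_le_one
    linarith
  · have h2 : r ^ (q + 2) ≤ (r ^ δ) ^ k := by
      rw [← rpow_natCast, ← rpow_mul hr.le]
      exact rpow_le_rpow_of_exponent_le h1 hkδ
    have h3 : r ^ q * (1 + r ^ 2) ≤ 2 * r ^ (q + 2) := by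
      rw [rpow_add hr, rpow_two]
      have : 0 < r ^ q := by positivity
      have h5 : 1 + r ^ 2 ≤ 2 * r ^ 2 := by nlinarith
      nlinarith
    have h4 := Real.pow_div_factorial_le_exp (m * r ^ δ) (by positivity) k
    rw [mul_pow, div_le_iff₀ hf] at h4
    have h6 : r ^ (q + 2) * exp (-m * r ^ δ) ≤ k.factorial / m ^ k := by
      rw [neg_mul, exp_neg, ← div_eq_mul_inv, div_le_div_iff₀ (exp_pos _) (by positivity)]
      have : 0 < m ^ k := by positivity
      nlinarith
    have h7 := mul_le_mul_of_nonneg_right h3 (exp_pos (-m * r ^ δ)).le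
    linarith

theorem integral_le_of_le_inv_one_add_sq {f : ℝ → ℝ} {C L : ℝ} (hC : 0 ≤ C) (hL : 0 ≤ L)
    (hf : IntervalIntegrable f volume 0 L)
    (h : ∀ r ∈ Ioo 0 L, f r ≤ C * (1 + r ^ 2)⁻¹) : ∫ r in 0..L, f r ≤ C * π := by
  have hi : IntervalIntegrable (fun r : ℝ => C * (1 + r ^ 2)⁻¹) volume 0 L := by
    apply Continuous.intervalIntegrable
    exact continuous_const.mul (Continuous.inv₀ (by fun_prop) fun r => by positivity)
  refine (intervalIntegral.integral_mono_on_of_le_Ioo hL hf hi h).trans ?_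
  rw [intervalIntegral.integral_const_mul, integral_inv_one_add_sq, arctan_zero, sub_zero]
  exact mul_le_mul_of_nonneg_left ((arctan_lt_pi_div_two L).le.trans (by linarith [pi_pos])) hC

/-- A nonnegative function on the half-line with bounded first moment is integrable, with tails
controlled by that moment. -/
theorem integrableOn_Ioi_of_moment_le {f : ℝ → ℝ} {C : ℝ} (hf : ContinuousOn f (Ici 0))
    (h0 : ∀ r, 0 < r → 0 ≤ f r) (hC : ∀ L : ℝ, 0 < L → ∫ r in 0..L, r * f r ≤ C) :
    IntegrableOn f (Ioi 0) ∧
      ∀ L : ℝ, 0 < L → |(∫ r in Ioi (0:ℝ), f r) - ∫ r in 0..L, f r| ≤ C / L := by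
  have hi : ∀ a b : ℝ, 0 ≤ a → a ≤ b → IntervalIntegrable f volume a b := fun a b ha hab =>
    (hf.mono fun x hx => by
      rw [uIcc_of_le hab] at hx
      exact ha.trans hx.1).intervalIntegrable
  have hi' : ∀ a b : ℝ, 0 ≤ a → a ≤ b → IntervalIntegrable (fun r => r * f r) volume a b :=
    fun a b ha hab => (hi a b ha hab).continuousOn_mul continuousOn_id
  have tail : ∀ a b : ℝ, 0 < a → a ≤ b →
      0 ≤ ∫ r in a..b, f r ∧ ∫ r in a..b, f r ≤ C / a := by
    intro a b ha hab
    refine ⟨intervalIntegral.integral_nonneg hab fun x hx => h0 x (ha.trans_le hx.1), ?_⟩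
    rw [le_div_iff₀ ha, ← intervalIntegral.integral_mul_const]
    calc ∫ r in a..b, f r * a ≤ ∫ r in a..b, r * f r := by
          refine intervalIntegral.integral_mono_on hab ((hi a b ha.le hab).mul_const a)
            (hi' a b ha.le hab) fun x hx => ?_
          rw [mul_comm]
          exact mul_le_mul_of_nonneg_right hx.1 (h0 x (ha.trans_le hx.1))
      _ ≤ ∫ r in 0..b, r * f r := by
          rw [← intervalIntegral.integral_add_adjacent_intervals (hi' 0 a le_rfl ha.le)
            (hi' a b ha.le hab)]
          have : 0 ≤ ∫ r in 0..a, r * f r := by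
            rw [intervalIntegral.integral_of_le ha.le]
            exact setIntegral_nonneg measurableSet_Ioc fun x hx => mul_nonneg hx.1.le (h0 x hx.1)
          linarith
      _ ≤ C := hC b (ha.trans_le hab)
  have split : ∀ a b : ℝ, 0 ≤ a → a ≤ b →
      ∫ r in 0..b, f r = (∫ r in 0..a, f r) + ∫ r in a..b, f r := fun a b ha hab =>
    (intervalIntegral.integral_add_adjacent_intervals (hi 0 a le_rfl ha) (hi a b ha hab)).symm
  have hint : IntegrableOn f (Ioi 0) := by
    refine integrableOn_Ioi_of_intervalIntegral_norm_bounded (l := atTop)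
      (b := fun x : ℝ => max x 0) ((∫ r in 0..1, f r) + C / 1) 0 (fun x => ?_)
      (tendsto_atTop_mono (fun x => le_max_left x 0) tendsto_id) ?_
    · exact (intervalIntegrable_iff_integrableOn_Ioc_of_le (le_max_right _ _)).1
        (hi 0 _ le_rfl (le_max_right _ _))
    · filter_upwards [eventually_ge_atTop 1] with x hx
      rw [max_eq_left (by linarith)]
      have : ∫ r in 0..x, ‖f r‖ = ∫ r in 0..x, f r := by
        refine intervalIntegral.integral_congr_uIoo fun r hr => ?_
        rw [uIoo_of_le (by linarith)] at hr
        exact abs_of_nonneg (h0 r hr.1)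
      rw [this, split 1 x zero_le_one hx]
      linarith [(tail 1 x one_pos hx).2]
  refine ⟨hint, fun L hL => ?_⟩
  have hlim := (intervalIntegral_tendsto_integral_Ioi 0 hint tendsto_id).sub_const
    (∫ r in 0..L, f r)
  refine le_of_tendsto hlim.abs ?_
  filter_upwards [eventually_ge_atTop L] with x hx
  simp only [id]
  rw [split L x hL.le hx, add_sub_cancel_left, abs_of_nonneg (tail L x hL hx).1]
  exact (tail L x hL hx).2

theorem ContinuousOn.exists_bound_nhds_Icc {f : ℝ × ℝ → ℝ} {T τ L : ℝ}
    (hf : ContinuousOn f (Ioo 0 T ×ˢ Ici 0)) (hτ : τ ∈ Ioo 0 T) :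
    ∃ ε : ℝ, 0 < ε ∧ ∃ K : ℝ, 0 ≤ K ∧ ∀ t ∈ Ioo (τ - ε) (τ + ε), t ∈ Ioo 0 T ∧
      ∀ r ∈ Icc 0 L, |f (t, r)| ≤ K := by
  obtain ⟨h0, hT⟩ := hτ
  set ε := min τ (T - τ) / 2 with hε
  have h1 : min τ (T - τ) ≤ τ := min_le_left _ _
  have h2 : min τ (T - τ) ≤ T - τ := min_le_right _ _
  have h3 : 0 < min τ (T - τ) := lt_min h0 (by linarith)
  have hsub : Icc (τ - ε) (τ + ε) ⊆ Ioo 0 T := fun t ht =>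
    ⟨by linarith [ht.1], by linarith [ht.2]⟩
  obtain ⟨K, hK⟩ := (isCompact_Icc.prod isCompact_Icc).exists_bound_of_continuousOn
    (hf.mono (prod_mono hsub (Icc_subset_Ici_self : Icc (0 : ℝ) L ⊆ Ici 0)))
  exact ⟨ε, by linarith, |K|, abs_nonneg K, fun t ht =>
    ⟨hsub (Ioo_subset_Icc_self ht), fun r hr =>
      (hK (t, r) ⟨Ioo_subset_Icc_self ht, hr⟩).trans (le_abs_self K)⟩⟩

namespace IsCompleteSolution

section Regularity

variable {σ α β γ T τ r L : ℝ} {P : ℝ → ℝ → ℝ}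

theorem hasDerivAt_tau (hP : IsCompleteSolution σ α β γ T P) (hτ : τ ∈ Ioo 0 T) (hr : 0 ≤ r) :
    HasDerivAt (fun t => P t r) (pTau P τ r) τ :=
  (hP.diff_tau τ hτ r hr).hasDerivAt

theorem hasDerivAt_r (hP : IsCompleteSolution σ α β γ T P) (hτ : τ ∈ Ioo 0 T) (hr : 0 ≤ r) :
    HasDerivAt (P τ) (pR P τ r) r :=
  (hP.diff_r τ hτ r hr).hasDerivAt

theorem hasDerivAt_pR (hP : IsCompleteSolution σ α β γ T P) (hτ : τ ∈ Ioo 0 T) (hr : 0 ≤ r) :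
    HasDerivAt (pR P τ) (pRR P τ r) r :=
  (hP.diff_rr τ hτ r hr).hasDerivAt

theorem continuousOn_slice (hP : IsCompleteSolution σ α β γ T P) (hτ : τ ∈ Ioo 0 T) :
    ContinuousOn (P τ) (Ici 0) :=
  fun _ hx => (hP.hasDerivAt_r hτ hx).continuousAt.continuousWithinAt

theorem continuousOn_pR (hP : IsCompleteSolution σ α β γ T P) (hτ : τ ∈ Ioo 0 T) :
    ContinuousOn (pR P τ) (Ici 0) :=
  fun _ hx => (hP.hasDerivAt_pR hτ hx).continuousAt.continuousWithinAt

theorem continuousOn_pRR (hP : IsCompleteSolution σ α β γ T P) (hτ : τ ∈ Ioo 0 T) :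
    ContinuousOn (pRR P τ) (Ici 0) :=
  hP.cont_rr.comp (f := fun r => (τ, r)) (by fun_prop) fun _ hx => ⟨hτ, hx⟩

theorem continuousOn_pTau (hP : IsCompleteSolution σ α β γ T P) (hτ : τ ∈ Ioo 0 T) :
    ContinuousOn (pTau P τ) (Ici 0) :=
  hP.cont_tau.comp (f := fun r => (τ, r)) (by fun_prop) fun _ hx => ⟨hτ, hx⟩

theorem exists_bound (hP : IsCompleteSolution σ α β γ T P) :
    ∃ M : ℝ, 0 < M ∧ ∀ τ ∈ Ioo 0 T, ∀ r : ℝ, 0 < r → |P τ r| ≤ M ∧ |pR P τ r| ≤ M := by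
  obtain ⟨M, m, δ, hM, hm, hδ, h⟩ := hP.growth
  refine ⟨M, hM, fun τ hτ r hr => ⟨(h τ hτ r hr).1.trans ?_, (h τ hτ r hr).2⟩⟩
  refine mul_le_of_le_one_right hM.le ?_
  rw [exp_le_one_iff, neg_mul]
  exact neg_nonpos.2 (by positivity)

theorem exists_decay (hP : IsCompleteSolution σ α β γ T P) {q : ℝ} (hq : 0 ≤ q) :
    ∃ C : ℝ, 0 < C ∧ ∀ τ ∈ Ioo 0 T, ∀ r : ℝ, 0 < r →
      r ^ q * (|P τ r| * |pR P τ r|) ≤ C * (1 + r ^ 2)⁻¹ ∧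
      r ^ q * P τ r ^ 2 ≤ C * (1 + r ^ 2)⁻¹ := by
  obtain ⟨M', hM', hb⟩ := hP.exists_bound
  obtain ⟨M, m, δ, hM, hm, hδ, h⟩ := hP.growth
  obtain ⟨C, hC, hexp⟩ := exists_rpow_mul_exp_neg_mul_rpow_le hm hδ hq
  refine ⟨M * C * (1 + M'), by positivity, fun τ hτ r hr => ?_⟩
  have h1 : r ^ q * |P τ r| ≤ M * C * (1 + r ^ 2)⁻¹ := by
    calc r ^ q * |P τ r| ≤ r ^ q * (M * exp (-m * r ^ δ)) := by
          gcongr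
          exact (h τ hτ r hr).1
      _ = M * (r ^ q * exp (-m * r ^ δ)) := by ring
      _ ≤ M * (C * (1 + r ^ 2)⁻¹) := mul_le_mul_of_nonneg_left (hexp r hr) hM.le
      _ = _ := by ring
  have h2 : ∀ y : ℝ, 0 ≤ y → y ≤ 1 + M' →
      r ^ q * (|P τ r| * y) ≤ M * C * (1 + M') * (1 + r ^ 2)⁻¹ := fun y hy0 hy => by
    calc r ^ q * (|P τ r| * y) = r ^ q * |P τ r| * y := by ring
      _ ≤ M * C * (1 + r ^ 2)⁻¹ * (1 + M') := by gcongr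
      _ = _ := by ring
  obtain ⟨hb1, hb2⟩ := hb τ hτ r hr
  refine ⟨h2 _ (abs_nonneg _) (by linarith), ?_⟩
  have := h2 _ (abs_nonneg (P τ r)) (by linarith)
  rwa [← sq, sq_abs] at this

theorem hasDerivAt_integral_sq (hP : IsCompleteSolution σ α β γ T P) (hτ : τ ∈ Ioo 0 T)
    {q : ℝ} (hq : 0 ≤ q) (hL : 0 ≤ L) :
    HasDerivAt (fun t => ∫ r in 0..L, r ^ q * P t r ^ 2)
      (∫ r in 0..L, r ^ q * (2 * P τ r * pTau P τ r)) τ := by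
  obtain ⟨M, hM, hb⟩ := hP.exists_bound
  obtain ⟨ε, hε, K, hK, hKb⟩ := hP.cont_tau.exists_bound_nhds_Icc (L := L) hτ
  have hw : Continuous fun r : ℝ => r ^ q := continuous_rpow_const hq
  have hsub : uIcc 0 L ⊆ Ici 0 := by
    rw [uIcc_of_le hL]
    exact Icc_subset_Ici_self
  have hF : ∀ t ∈ Ioo 0 T, IntervalIntegrable (fun r => r ^ q * P t r ^ 2) volume 0 L :=
    fun t ht => ((hw.continuousOn.mul ((hP.continuousOn_slice ht).pow 2)).mono
      hsub).intervalIntegrable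
  have hF' : IntervalIntegrable (fun r => r ^ q * (2 * P τ r * pTau P τ r)) volume 0 L :=
    ((hw.continuousOn.mul ((continuousOn_const.mul (hP.continuousOn_slice hτ)).mul
      (hP.continuousOn_pTau hτ))).mono hsub).intervalIntegrable
  have hnhds : Ioo (τ - ε) (τ + ε) ∈ 𝓝 τ := Ioo_mem_nhds (by linarith) (by linarith)
  refine (intervalIntegral.hasDerivAt_integral_of_dominated_loc_of_deriv_le
    (F' := fun t r => r ^ q * (2 * P t r * pTau P t r))
    (bound := fun r => r ^ q * (2 * M * K)) hnhds ?_ (hF τ hτ)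
    hF'.def'.aestronglyMeasurable ?_ ?_ ?_).2
  · filter_upwards [hnhds] with t ht
    exact (hF t (hKb t ht).1).def'.aestronglyMeasurable
  · refine ae_of_all _ fun r hr t ht => ?_
    rw [uIoc_of_le hL] at hr
    have hr0 : 0 ≤ r ^ q := rpow_nonneg hr.1.le q
    rw [norm_eq_abs, abs_mul, abs_mul, abs_mul, abs_of_nonneg hr0, abs_two]
    have h1 := (hb t (hKb t ht).1 r hr.1).1
    have h2 := (hKb t ht).2 r (Ioc_subset_Icc_self hr)
    gcongr
  · exact (hw.mul continuous_const).intervalIntegrable _ _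
  · refine ae_of_all _ fun r hr t ht => ?_
    rw [uIoc_of_le hL] at hr
    simpa using ((hP.hasDerivAt_tau (hKb t ht).1 hr.1.le).fun_pow 2).const_mul (r ^ q)

theorem hasDerivAt_integral_mul_pR_sq (hP : IsCompleteSolution σ α β γ T P) (hτ : τ ∈ Ioo 0 T)
    (hL : 0 ≤ L) {w w' : ℝ → ℝ} (hw : ∀ r ∈ Icc 0 L, HasDerivAt w (w' r) r)
    (hw' : ContinuousOn w' (Icc 0 L)) (hw0 : w 0 = 0) (hwL : w L = 0) :
    HasDerivAt (fun t => ∫ r in 0..L, w r * pR P t r ^ 2)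
      (∫ r in 0..L, -2 * pTau P τ r * (w r * pRR P τ r + w' r * pR P τ r)) τ := by
  obtain ⟨ε, hε, K, hK, hKb⟩ := ContinuousOn.exists_bound_nhds_Icc (L := L)
    ((hP.cont_tau.abs.add hP.cont_r.abs).add hP.cont_rr.abs) hτ
  have hKb' : ∀ t ∈ Ioo (τ - ε) (τ + ε), ∀ r ∈ Icc 0 L,
      |pTau P t r| ≤ K ∧ |pR P t r| ≤ K ∧ |pRR P t r| ≤ K := by
    intro t ht r hr
    have h1 := (hKb t ht).2 r hr
    have h2 := le_abs_self (|pTau P t r| + |pR P t r| + |pRR P t r|)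
    have h3 := abs_nonneg (pTau P t r)
    have h4 := abs_nonneg (pR P t r)
    have h5 := abs_nonneg (pRR P t r)
    simp only [Pi.add_apply] at h1
    exact ⟨by linarith, by linarith, by linarith⟩
  have hwc : ContinuousOn w (Icc 0 L) := fun x hx => (hw x hx).continuousAt.continuousWithinAt
  obtain ⟨W, hW⟩ := isCompact_Icc.exists_bound_of_continuousOn hwc
  obtain ⟨W', hW'⟩ := isCompact_Icc.exists_bound_of_continuousOn hw'
  have hsub : Icc 0 L ⊆ Ici 0 := Icc_subset_Ici_self
  have hnhds : Ioo (τ - ε) (τ + ε) ∈ 𝓝 τ := Ioo_mem_nhds (by linarith) (by linarith)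
  have hτε : τ ∈ Ioo (τ - ε) (τ + ε) := mem_of_mem_nhds hnhds
  have hcont : ∀ t ∈ Ioo 0 T, ContinuousOn (fun r => -((t - τ)⁻¹ * (P t r - P τ r)) *
      (w' r * (pR P t r + pR P τ r) + w r * (pRR P t r + pRR P τ r))) (Icc 0 L) := by
    intro t ht
    have h1 := (hP.continuousOn_slice ht).mono hsub
    have h2 := (hP.continuousOn_slice hτ).mono hsub
    have h3 := (hP.continuousOn_pR ht).mono hsub
    have h4 := (hP.continuousOn_pR hτ).mono hsub
    have h5 := (hP.continuousOn_pRR ht).mono hsub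
    have h6 := (hP.continuousOn_pRR hτ).mono hsub
    fun_prop
  have hslope : ∀ t ∈ Ioo (τ - ε) (τ + ε),
      slope (fun t => ∫ r in 0..L, w r * pR P t r ^ 2) τ t =
        ∫ r in 0..L, -((t - τ)⁻¹ * (P t r - P τ r)) *
          (w' r * (pR P t r + pR P τ r) + w r * (pRR P t r + pRR P τ r)) := by
    intro t ht
    have htT := (hKb t ht).1
    have hi : ∀ s ∈ Ioo 0 T, IntervalIntegrable (fun r => w r * pR P s r ^ 2) volume 0 L :=
      fun s hs => ContinuousOn.intervalIntegrable_of_Icc hL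
        (hwc.mul (((hP.continuousOn_pR hs).mono hsub).pow 2))
    have hparts := intervalIntegral.integral_mul_deriv_eq_deriv_mul (a := 0) (b := L)
      (u := fun r => w r * (pR P t r + pR P τ r)) (v := fun r => P t r - P τ r)
      (u' := fun r => w' r * (pR P t r + pR P τ r) + w r * (pRR P t r + pRR P τ r))
      (v' := fun r => pR P t r - pR P τ r)
      (fun x hx => by
        rw [uIcc_of_le hL] at hx
        exact (hw x hx).mul ((hP.hasDerivAt_pR htT hx.1).add (hP.hasDerivAt_pR hτ hx.1)))
      (fun x hx => by
        rw [uIcc_of_le hL] at hx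
        exact (hP.hasDerivAt_r htT hx.1).sub (hP.hasDerivAt_r hτ hx.1))
      (ContinuousOn.intervalIntegrable_of_Icc hL (by
        have h3 := (hP.continuousOn_pR htT).mono hsub
        have h4 := (hP.continuousOn_pR hτ).mono hsub
        have h5 := (hP.continuousOn_pRR htT).mono hsub
        have h6 := (hP.continuousOn_pRR hτ).mono hsub
        fun_prop))
      (ContinuousOn.intervalIntegrable_of_Icc hL
        (((hP.continuousOn_pR htT).mono hsub).sub ((hP.continuousOn_pR hτ).mono hsub)))
    rw [slope_def_module, smul_eq_mul, ← intervalIntegral.integral_sub (hi t htT) (hi τ hτ)]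
    have hsq : ∫ r in 0..L, (w r * pR P t r ^ 2 - w r * pR P τ r ^ 2) =
        ∫ r in 0..L, w r * (pR P t r + pR P τ r) * (pR P t r - pR P τ r) :=
      intervalIntegral.integral_congr fun r _ => by ring
    rw [hsq, hparts, hw0, hwL]
    simp only [zero_mul, sub_zero, zero_sub, mul_neg]
    rw [← intervalIntegral.integral_const_mul, ← intervalIntegral.integral_neg]
    exact intervalIntegral.integral_congr fun r _ => by ring
  rw [hasDerivAt_iff_tendsto_slope]
  have hnhds' : Ioo (τ - ε) (τ + ε) ∈ 𝓝[≠] τ := mem_nhdsWithin_of_mem_nhds hnhds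
  refine Tendsto.congr' (f₁ := fun t => ∫ r in 0..L, -((t - τ)⁻¹ * (P t r - P τ r)) *
    (w' r * (pR P t r + pR P τ r) + w r * (pRR P t r + pRR P τ r))) ?_ ?_
  · filter_upwards [hnhds'] with t ht using (hslope t ht).symm
  refine intervalIntegral.tendsto_integral_filter_of_dominated_convergence
    (fun _ => K * (W' * (K + K) + W * (K + K))) ?_ ?_ (intervalIntegrable_const) ?_
  · filter_upwards [hnhds'] with t ht
    exact (ContinuousOn.intervalIntegrable_of_Icc hL
      (hcont t (hKb t ht).1)).def'.aestronglyMeasurable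
  · filter_upwards [hnhds', self_mem_nhdsWithin] with t ht htne
    refine ae_of_all _ fun r hr => ?_
    rw [uIoc_of_le hL] at hr
    have hr' := Ioc_subset_Icc_self hr
    have hne : t - τ ≠ 0 := sub_ne_zero.2 htne
    have hmvt : |(t - τ)⁻¹ * (P t r - P τ r)| ≤ K := by
      have := (convex_Ioo (τ - ε) (τ + ε)).norm_image_sub_le_of_norm_hasDerivWithin_le
        (f := fun s => P s r) (f' := fun s => pTau P s r)
        (fun s hs => (hP.hasDerivAt_tau (hKb s hs).1 hr.1.le).hasDerivWithinAt)
        (fun s hs => (hKb' s hs r hr').1) hτε ht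
      rw [abs_mul, abs_inv, inv_mul_le_iff₀ (abs_pos.2 hne), mul_comm]
      exact this
    have hW1 := hW r hr'
    have hW2 := hW' r hr'
    rw [norm_eq_abs] at hW1 hW2
    have hW0 : 0 ≤ W := (abs_nonneg _).trans hW1
    have hW0' : 0 ≤ W' := (abs_nonneg _).trans hW2
    obtain ⟨-, b1, b2⟩ := hKb' t ht r hr'
    obtain ⟨-, b3, b4⟩ := hKb' τ hτε r hr'
    rw [norm_eq_abs, abs_mul, abs_neg]
    refine mul_le_mul hmvt ((abs_add_le _ _).trans ?_) (abs_nonneg _) hK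
    rw [abs_mul, abs_mul]
    exact add_le_add
      (mul_le_mul hW2 ((abs_add_le _ _).trans (add_le_add b1 b3)) (abs_nonneg _) hW0')
      (mul_le_mul hW1 ((abs_add_le _ _).trans (add_le_add b2 b4)) (abs_nonneg _) hW0)
  · refine ae_of_all _ fun r hr => ?_
    rw [uIoc_of_le hL] at hr
    have hslice : ∀ {f : ℝ × ℝ → ℝ}, ContinuousOn f (Ioo 0 T ×ˢ Ici 0) →
        Tendsto (fun t => f (t, r)) (𝓝[≠] τ) (𝓝 (f (τ, r))) := by
      intro f hf
      have h1 : ContinuousOn (fun t => f (t, r)) (Ioo 0 T) :=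
        hf.comp (f := fun t => (t, r)) (by fun_prop) fun t ht => ⟨ht, hr.1.le⟩
      exact (h1.continuousAt (Ioo_mem_nhds hτ.1 hτ.2)).tendsto.mono_left nhdsWithin_le_nhds
    have h1 : Tendsto (fun t => (t - τ)⁻¹ * (P t r - P τ r)) (𝓝[≠] τ) (𝓝 (pTau P τ r)) :=
      (hP.hasDerivAt_tau hτ hr.1.le).tendsto_slope
    have h2 := hslice hP.cont_r
    have h3 := hslice hP.cont_rr
    have := h1.neg.mul (((h2.add_const (pR P τ r)).const_mul (w' r)).add
      ((h3.add_const (pRR P τ r)).const_mul (w r)))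
    convert this using 2
    ring

end Regularity

section CIR

variable {σ α β T τ L : ℝ} {P : ℝ → ℝ → ℝ}

theorem pTau_eq (hP : IsCompleteSolution σ α β (1 / 2) T P) (hτ : τ ∈ Ioo 0 T) {r : ℝ}
    (hr : 0 < r) :
    pTau P τ r = σ ^ 2 / 2 * r * pRR P τ r + ((α + β * r) * pR P τ r - r * P τ r) := by
  have h := hP.pde τ hτ r hr
  rw [show 2 * (1 / 2 : ℝ) = 1 by norm_num, rpow_one] at h
  linarith

theorem intervalIntegrable_rpow_mul {q : ℝ} (hq : 0 ≤ q) (hL : 0 ≤ L) {f : ℝ → ℝ}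
    (hf : ContinuousOn f (Ici 0)) : IntervalIntegrable (fun r => r ^ q * f r) volume 0 L :=
  ContinuousOn.intervalIntegrable_of_Icc hL
    (((continuous_rpow_const hq).continuousOn.mul hf).mono Icc_subset_Ici_self)

/-- The weighted energy identity on `[0, L]`. -/
theorem integral_rpow_mul_pTau (hP : IsCompleteSolution σ α β (1 / 2) T P) (hτ : τ ∈ Ioo 0 T)
    {q : ℝ} (hq : 0 ≤ q) (hL : 0 ≤ L) :
    ∫ r in 0..L, r ^ q * (2 * P τ r * pTau P τ r) =
      L ^ (q + 1) * (σ ^ 2 * (P τ L * pR P τ L) + β * P τ L ^ 2) +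
        ((2 * α - σ ^ 2 * (q + 1)) * ∫ r in 0..L, r ^ q * (P τ r * pR P τ r)) -
        ((q + 1) * β * ∫ r in 0..L, r ^ q * P τ r ^ 2) -
        ∫ r in 0..L, r ^ (q + 1) * (2 * P τ r ^ 2 + σ ^ 2 * pR P τ r ^ 2) := by
  have c0 := hP.continuousOn_slice hτ
  have c1 := hP.continuousOn_pR hτ
  have c2 := hP.continuousOn_pRR hτ
  have i1 : IntervalIntegrable (fun r => (2 * α - σ ^ 2 * (q + 1)) *
      (r ^ q * (P τ r * pR P τ r))) volume 0 L :=
    (intervalIntegrable_rpow_mul hq hL (c0.mul c1)).const_mul _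
  have i2 : IntervalIntegrable (fun r => (q + 1) * β * (r ^ q * P τ r ^ 2)) volume 0 L :=
    (intervalIntegrable_rpow_mul hq hL (c0.pow 2)).const_mul _
  have i3 : IntervalIntegrable
      (fun r => r ^ (q + 1) * (2 * P τ r ^ 2 + σ ^ 2 * pR P τ r ^ 2)) volume 0 L :=
    intervalIntegrable_rpow_mul (by linarith) hL (by fun_prop)
  have i4 : IntervalIntegrable (fun r => (q + 1) * r ^ q *
      (σ ^ 2 * (P τ r * pR P τ r) + β * P τ r ^ 2) + r ^ (q + 1) *
      (σ ^ 2 * (pR P τ r * pR P τ r + P τ r * pRR P τ r) + β * (2 * P τ r * pR P τ r)))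
      volume 0 L := by
    simp only [mul_assoc (q + 1)]
    exact ((intervalIntegrable_rpow_mul hq hL (by fun_prop)).const_mul _).add
      (intervalIntegrable_rpow_mul (by linarith) hL (by fun_prop))
  have ftc := intervalIntegral.integral_eq_sub_of_hasDerivAt (a := 0) (b := L)
    (f := fun r => r ^ (q + 1) * (σ ^ 2 * (P τ r * pR P τ r) + β * P τ r ^ 2))
    (fun r hr => by
      rw [uIcc_of_le hL] at hr
      have h0 := hP.hasDerivAt_r hτ hr.1
      have h1 := hP.hasDerivAt_pR hτ hr.1
      have hw := Real.hasDerivAt_rpow_const (x := r) (p := q + 1) (Or.inr (by linarith))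
      rw [add_sub_cancel_right] at hw
      refine (hw.fun_mul (((h0.fun_mul h1).const_mul (σ ^ 2)).fun_add
        ((h0.fun_pow 2).const_mul β))).congr_deriv ?_
      norm_num) i4
  rw [zero_rpow (by linarith), zero_mul, sub_zero] at ftc
  rw [← ftc, ← intervalIntegral.integral_const_mul, ← intervalIntegral.integral_const_mul,
    ← intervalIntegral.integral_add i4 i1,
    ← intervalIntegral.integral_sub (i4.add i1) i2,
    ← intervalIntegral.integral_sub ((i4.add i1).sub i2) i3]
  refine intervalIntegral.integral_congr_uIoo fun r hr => ?_
  rw [uIoo_of_le hL] at hr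
  rw [hP.pTau_eq hτ hr.1, rpow_add_one hr.1.ne']
  ring

theorem exists_boundary_bound (hP : IsCompleteSolution σ α β (1 / 2) T P) {q : ℝ} (hq : 0 ≤ q) :
    ∃ C : ℝ, 0 < C ∧ ∀ τ ∈ Ioo 0 T, ∀ L : ℝ, 0 < L →
      |L ^ q * (σ ^ 2 * (P τ L * pR P τ L) + β * P τ L ^ 2)| ≤ C * (1 + L ^ 2)⁻¹ := by
  obtain ⟨C, hC, h⟩ := hP.exists_decay hq
  refine ⟨(σ ^ 2 + |β| + 1) * C, by positivity, fun τ hτ L hL => ?_⟩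
  obtain ⟨h1, h2⟩ := h τ hτ L hL
  have hL0 : 0 ≤ L ^ q := rpow_nonneg hL.le q
  calc |L ^ q * (σ ^ 2 * (P τ L * pR P τ L) + β * P τ L ^ 2)|
      ≤ L ^ q * (σ ^ 2 * (|P τ L| * |pR P τ L|) + |β| * P τ L ^ 2) := by
        rw [abs_mul, abs_of_nonneg hL0]
        refine mul_le_mul_of_nonneg_left ((abs_add_le _ _).trans_eq ?_) hL0
        rw [abs_mul, abs_mul, abs_mul, abs_of_nonneg (sq_nonneg σ),
          abs_of_nonneg (sq_nonneg (P τ L))]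
    _ = σ ^ 2 * (L ^ q * (|P τ L| * |pR P τ L|)) + |β| * (L ^ q * P τ L ^ 2) := by ring
    _ ≤ σ ^ 2 * (C * (1 + L ^ 2)⁻¹) + |β| * (C * (1 + L ^ 2)⁻¹) := by gcongr
    _ ≤ (σ ^ 2 + |β| + 1) * C * (1 + L ^ 2)⁻¹ := by
        have : 0 < C * (1 + L ^ 2)⁻¹ := by positivity
        linarith

theorem exists_integral_sq_bound (hP : IsCompleteSolution σ α β (1 / 2) T P) {q : ℝ}
    (hq : 0 ≤ q) :
    ∃ C : ℝ, 0 < C ∧ ∀ τ ∈ Ioo 0 T, ∀ L : ℝ, 0 < L → ∫ r in 0..L, r ^ q * P τ r ^ 2 ≤ C := by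
  obtain ⟨C, hC, h⟩ := hP.exists_decay hq
  exact ⟨C * π, by positivity, fun τ hτ L hL =>
    integral_le_of_le_inv_one_add_sq hC.le hL.le
      (intervalIntegrable_rpow_mul hq hL.le ((hP.continuousOn_slice hτ).pow 2))
      fun r hr => (h τ hτ r hr.1).2⟩

theorem integral_rpow_mul_sq_nonneg (q : ℝ) (hL : 0 ≤ L) (f : ℝ → ℝ) :
    0 ≤ ∫ r in 0..L, r ^ q * f r ^ 2 :=
  intervalIntegral.integral_nonneg hL fun _ hr => mul_nonneg (rpow_nonneg hr.1 q) (sq_nonneg _)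

theorem exists_energy_dissipation (hP : IsCompleteSolution σ α β (1 / 2) T P) {q : ℝ}
    (hq : 0 ≤ q) :
    ∃ C : ℝ, 0 < C ∧ ∀ τ ∈ Ioo 0 T, ∀ L : ℝ, 0 < L →
      ∫ r in 0..L, r ^ q * (2 * P τ r * pTau P τ r) ≤
        C - σ ^ 2 * ∫ r in 0..L, r ^ (q + 1) * pR P τ r ^ 2 := by
  obtain ⟨C₁, hC₁, h₁⟩ := hP.exists_boundary_bound (q := q + 1) (by linarith)
  obtain ⟨C₂, hC₂, h₂⟩ := hP.exists_decay hq
  obtain ⟨C₃, hC₃, h₃⟩ := hP.exists_integral_sq_bound hq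
  refine ⟨C₁ + |2 * α - σ ^ 2 * (q + 1)| * (C₂ * π) + |(q + 1) * β| * C₃, by positivity,
    fun τ hτ L hL => ?_⟩
  have c0 := hP.continuousOn_slice hτ
  have c1 := hP.continuousOn_pR hτ
  rw [hP.integral_rpow_mul_pTau hτ hq hL.le]
  have e1 : L ^ (q + 1) * (σ ^ 2 * (P τ L * pR P τ L) + β * P τ L ^ 2) ≤ C₁ :=
    ((le_abs_self _).trans (h₁ τ hτ L hL)).trans
      (mul_le_of_le_one_right hC₁.le (inv_le_one_of_one_le₀ (by nlinarith)))
  have e2 : (2 * α - σ ^ 2 * (q + 1)) * (∫ r in 0..L, r ^ q * (P τ r * pR P τ r)) ≤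
      |2 * α - σ ^ 2 * (q + 1)| * (C₂ * π) := by
    refine (le_abs_self _).trans ?_
    rw [abs_mul]
    refine mul_le_mul_of_nonneg_left ((intervalIntegral.abs_integral_le_integral_abs hL.le).trans
      (integral_le_of_le_inv_one_add_sq hC₂.le hL.le
        (intervalIntegrable_rpow_mul hq hL.le (c0.mul c1)).abs fun r hr => ?_)) (abs_nonneg _)
    rw [abs_mul, abs_mul, abs_of_nonneg (rpow_nonneg hr.1.le q)]
    exact (h₂ τ hτ r hr.1).1
  have e3 : -((q + 1) * β * ∫ r in 0..L, r ^ q * P τ r ^ 2) ≤ |(q + 1) * β| * C₃ := by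
    refine (neg_le_abs _).trans ?_
    rw [abs_mul]
    refine mul_le_mul_of_nonneg_left ?_ (abs_nonneg _)
    rw [abs_of_nonneg (integral_rpow_mul_sq_nonneg q hL.le _)]
    exact h₃ τ hτ L hL
  have e4 : σ ^ 2 * (∫ r in 0..L, r ^ (q + 1) * pR P τ r ^ 2) ≤
      ∫ r in 0..L, r ^ (q + 1) * (2 * P τ r ^ 2 + σ ^ 2 * pR P τ r ^ 2) := by
    rw [← intervalIntegral.integral_const_mul]
    refine intervalIntegral.integral_mono_on hL.le
      ((intervalIntegrable_rpow_mul (by linarith) hL.le (by fun_prop)).const_mul _)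
      (intervalIntegrable_rpow_mul (by linarith) hL.le (by fun_prop)) fun r hr => ?_
    have : 0 ≤ r ^ (q + 1) * (2 * P τ r ^ 2) :=
      mul_nonneg (rpow_nonneg hr.1 _) (by positivity)
    linarith
  linarith

theorem neg_two_mul_mul_le {κ r φ ψ X Y p b B N : ℝ} (hκ : 0 < κ) (hr : 0 < r) (hφ0 : 0 ≤ φ)
    (hφ1 : φ ≤ 1) (hψ : |ψ| ≤ N) (hb : |b| ≤ B * (1 + r)) :
    -2 * (κ * r * X + (b * Y - r * p)) * (φ * (r * φ * X + ψ * Y)) ≤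
      2 * (B + 1 + κ * N) ^ 2 / κ * ((1 + r ^ 2) * (Y ^ 2 + p ^ 2)) := by
  have hN : 0 ≤ N := (abs_nonneg _).trans hψ
  have hB : 0 ≤ B := by
    have := (abs_nonneg _).trans hb
    by_contra! h
    nlinarith
  set c := B + 1 + κ * N with hc
  have hc0 : 0 ≤ c := by positivity
  have habs : |φ * (b * Y - r * p) - κ * ψ * Y| ≤ c * (1 + r) * (|Y| + |p|) := by
    have hY := abs_nonneg Y
    have hp := abs_nonneg p
    have h1 : |φ * (b * Y - r * p)| ≤ B * (1 + r) * |Y| + r * |p| := by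
      rw [abs_mul, abs_of_nonneg hφ0]
      refine (mul_le_of_le_one_left (abs_nonneg _) hφ1).trans ((abs_sub _ _).trans ?_)
      rw [abs_mul, abs_mul, abs_of_pos hr]
      gcongr
    have h2 : |κ * ψ * Y| ≤ κ * N * |Y| := by
      rw [abs_mul, abs_mul, abs_of_pos hκ]
      gcongr
    refine ((abs_sub _ _).trans (add_le_add h1 h2)).trans ?_
    have h3 : 0 ≤ κ * N * r * |Y| + κ * N * (1 + r) * |p| + B * (1 + r) * |p| +
      (1 + r) * |Y| + |p| := by positivity
    rw [hc]
    linarith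
  have hsq : (φ * (b * Y - r * p) - κ * ψ * Y) ^ 2 ≤
      4 * c ^ 2 * ((1 + r ^ 2) * (Y ^ 2 + p ^ 2)) := by
    calc (φ * (b * Y - r * p) - κ * ψ * Y) ^ 2 ≤ (c * (1 + r) * (|Y| + |p|)) ^ 2 := by
          rw [← sq_abs]
          gcongr
      _ = c ^ 2 * ((1 + r) ^ 2 * (|Y| + |p|) ^ 2) := by ring
      _ ≤ c ^ 2 * ((2 * (1 + r ^ 2)) * (2 * (Y ^ 2 + p ^ 2))) := by
          have h1 : (1 + r) ^ 2 ≤ 2 * (1 + r ^ 2) := by linarith [sq_nonneg (1 - r)]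
          have h2 : (|Y| + |p|) ^ 2 ≤ 2 * (Y ^ 2 + p ^ 2) := by
            linarith [sq_nonneg (|Y| - |p|), sq_abs Y, sq_abs p]
          gcongr
      _ = _ := by ring
  have hkey : κ * (-2 * (κ * r * X + (b * Y - r * p)) * (φ * (r * φ * X + ψ * Y))) ≤
      (φ * (b * Y - r * p) - κ * ψ * Y) ^ 2 / 2 := by
    linarith [sq_nonneg (2 * (κ * r * φ * X) + φ * (b * Y - r * p) + κ * ψ * Y)]
  rw [div_mul_eq_mul_div, le_div_iff₀ hκ]
  linarith

end CIR

section Gradient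

variable {σ α β T : ℝ} {P : ℝ → ℝ → ℝ}

theorem rpow_add_two_eq {q r : ℝ} (hq : 0 ≤ q) (hr : 0 ≤ r) :
    r ^ (q + 2) = r ^ (q + 1) * r := by
  rw [← rpow_add_one' hr (by linarith)]
  ring_nf

theorem hasDerivAt_rpow_mul_cutoff {q r L : ℝ} (hq : 0 ≤ q) (hr : 0 ≤ r) :
    HasDerivAt (fun r : ℝ => r ^ (q + 2) * (1 - r / L) ^ 2)
      (r ^ (q + 1) * ((1 - r / L) * ((q + 2) * (1 - r / L) - 2 * (r / L)))) r := by
  have h1 := Real.hasDerivAt_rpow_const (x := r) (p := q + 2) (Or.inr (by linarith))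
  have h2 := (((hasDerivAt_id' r).div_const L).const_sub 1).fun_pow 2
  refine (h1.fun_mul h2).congr_deriv ?_
  rw [show q + 2 - 1 = q + 1 by ring, rpow_add_two_eq hq hr]
  norm_num
  ring

theorem integral_cutoff_mul_pR_sq_le (hP : IsCompleteSolution σ α β (1 / 2) T P) {q τ L : ℝ}
    (hq : 0 ≤ q) (hτ : τ ∈ Ioo 0 T) (hL : 0 < L) :
    ∫ r in 0..L, r ^ (q + 2) * (1 - r / L) ^ 2 * pR P τ r ^ 2 ≤
      (∫ r in 0..L, r ^ (q + 1) * pR P τ r ^ 2) +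
        ∫ r in 0..L, r ^ (q + 2 + 1) * pR P τ r ^ 2 := by
  have c1 := hP.continuousOn_pR hτ
  have j1 : IntervalIntegrable (fun r => r ^ (q + 1) * pR P τ r ^ 2) volume 0 L :=
    intervalIntegrable_rpow_mul (by linarith) hL.le (c1.pow 2)
  have j3 : IntervalIntegrable (fun r => r ^ (q + 2 + 1) * pR P τ r ^ 2) volume 0 L :=
    intervalIntegrable_rpow_mul (by linarith) hL.le (c1.pow 2)
  have hw : IntervalIntegrable
      (fun r => r ^ (q + 2) * ((1 - r / L) ^ 2 * pR P τ r ^ 2)) volume 0 L :=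
    intervalIntegrable_rpow_mul (by linarith) hL.le (by fun_prop)
  simp only [← mul_assoc] at hw
  rw [← intervalIntegral.integral_add j1 j3]
  refine intervalIntegral.integral_mono_on_of_le_Ioo hL.le hw (j1.add j3) fun r hr => ?_
  have hφ0 : 0 ≤ 1 - r / L := sub_nonneg.2 ((div_le_one hL).2 hr.2.le)
  have hφ1 : 1 - r / L ≤ 1 := sub_le_self _ (div_nonneg hr.1.le hL.le)
  have hφ2 : (1 - r / L) ^ 2 ≤ 1 := pow_le_one₀ hφ0 hφ1
  have hr0 : 0 ≤ r ^ (q + 1) := rpow_nonneg hr.1.le _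
  have hr1 := hr.1.le
  rw [rpow_add_one hr.1.ne' (q + 2), rpow_add_two_eq hq hr1]
  calc r ^ (q + 1) * r * (1 - r / L) ^ 2 * pR P τ r ^ 2
      ≤ r ^ (q + 1) * r * 1 * pR P τ r ^ 2 := by gcongr
    _ = r ^ (q + 1) * pR P τ r ^ 2 * r := by ring
    _ ≤ r ^ (q + 1) * pR P τ r ^ 2 * (1 + r ^ 2) :=
        mul_le_mul_of_nonneg_left (by nlinarith [sq_nonneg (r - 1)]) (by positivity)
    _ = _ := by ring

theorem exists_cutoff_dissipation (hσ : 0 < σ) (hP : IsCompleteSolution σ α β (1 / 2) T P)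
    {q : ℝ} (hq : 0 ≤ q) :
    ∃ c : ℝ, 0 ≤ c ∧ ∀ τ ∈ Ioo 0 T, ∀ L : ℝ, 0 < L →
      ∫ r in 0..L, -2 * pTau P τ r * (r ^ (q + 2) * (1 - r / L) ^ 2 * pRR P τ r +
        r ^ (q + 1) * ((1 - r / L) * ((q + 2) * (1 - r / L) - 2 * (r / L))) * pR P τ r) ≤
      c * (((∫ r in 0..L, r ^ (q + 1) * pR P τ r ^ 2) +
          ∫ r in 0..L, r ^ (q + 2 + 1) * pR P τ r ^ 2) +
        ((∫ r in 0..L, r ^ (q + 1) * P τ r ^ 2) +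
          ∫ r in 0..L, r ^ (q + 2 + 1) * P τ r ^ 2)) := by
  have hq1 : 0 ≤ q + 1 := by linarith
  have hq2 : 0 ≤ q + 2 := by linarith
  have hq3 : 0 ≤ q + 2 + 1 := by linarith
  have hκ : 0 < σ ^ 2 / 2 := by positivity
  refine ⟨2 * (|α| + |β| + 1 + σ ^ 2 / 2 * (q + 4)) ^ 2 / (σ ^ 2 / 2), by positivity,
    fun τ hτ L hL => ?_⟩
  have hsub : Icc 0 L ⊆ Ici 0 := Icc_subset_Ici_self
  have c0 := hP.continuousOn_slice hτ
  have c1 := hP.continuousOn_pR hτ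
  have c2 := hP.continuousOn_pRR hτ
  have c3 := hP.continuousOn_pTau hτ
  have j1 : IntervalIntegrable (fun r => r ^ (q + 1) * pR P τ r ^ 2) volume 0 L :=
    intervalIntegrable_rpow_mul hq1 hL.le (c1.pow 2)
  have j3 : IntervalIntegrable (fun r => r ^ (q + 2 + 1) * pR P τ r ^ 2) volume 0 L :=
    intervalIntegrable_rpow_mul hq3 hL.le (c1.pow 2)
  have k1 : IntervalIntegrable (fun r => r ^ (q + 1) * P τ r ^ 2) volume 0 L :=
    intervalIntegrable_rpow_mul hq1 hL.le (c0.pow 2)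
  have k3 : IntervalIntegrable (fun r => r ^ (q + 2 + 1) * P τ r ^ 2) volume 0 L :=
    intervalIntegrable_rpow_mul hq3 hL.le (c0.pow 2)
  rw [← intervalIntegral.integral_add j1 j3, ← intervalIntegral.integral_add k1 k3,
    ← intervalIntegral.integral_add (j1.add j3) (k1.add k3),
    ← intervalIntegral.integral_const_mul]
  refine intervalIntegral.integral_mono_on_of_le_Ioo hL.le
    (ContinuousOn.intervalIntegrable_of_Icc hL.le ?_)
    (((j1.add j3).add (k1.add k3)).const_mul _) fun r hr => ?_
  · have w1 := continuous_rpow_const hq1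
    have w2 := continuous_rpow_const hq2
    have d1 := c1.mono hsub
    have d2 := c2.mono hsub
    have d3 := c3.mono hsub
    fun_prop
  have hr0 : 0 ≤ r ^ (q + 1) := rpow_nonneg hr.1.le _
  have hx0 : 0 ≤ r / L := div_nonneg hr.1.le hL.le
  have hx1 : r / L ≤ 1 := (div_le_one hL).2 hr.2.le
  have hψ : |(q + 2) * (1 - r / L) - 2 * (r / L)| ≤ q + 4 := by
    have h1 : 0 ≤ q * (r / L) := mul_nonneg hq hx0
    have h2 : q * (r / L) ≤ q := mul_le_of_le_one_right hq hx1
    rw [abs_le]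
    constructor <;> linarith
  have hb : |α + β * r| ≤ (|α| + |β|) * (1 + r) := by
    refine (abs_add_le _ _).trans ?_
    rw [abs_mul, abs_of_pos hr.1]
    have h1 : 0 ≤ |α| * r := mul_nonneg (abs_nonneg α) hr.1.le
    linarith [abs_nonneg β]
  have key := mul_le_mul_of_nonneg_left (neg_two_mul_mul_le (X := pRR P τ r) (Y := pR P τ r)
    (p := P τ r) hκ hr.1 (sub_nonneg.2 hx1) (sub_le_self 1 hx0) hψ hb) hr0
  rw [rpow_add_one hr.1.ne' (q + 2), rpow_add_two_eq hq hr.1.le, hP.pTau_eq hτ hr.1]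
  refine (le_of_eq ?_).trans (key.trans_eq ?_) <;> ring

theorem exists_cutoff_gradient_bound (hσ : 0 < σ) (hP : IsCompleteSolution σ α β (1 / 2) T P)
    {q : ℝ} (hq : 0 ≤ q) {s : ℝ} (hs : s ∈ Ioo 0 T) :
    ∃ C : ℝ, 0 < C ∧ ∀ t ∈ Ioo s T, ∀ L : ℝ, 0 < L →
      (t - s) * (∫ r in 0..L, r ^ (q + 2) * (1 - r / L) ^ 2 * pR P t r ^ 2) ≤ C := by
  have hq1 : 0 ≤ q + 1 := by linarith
  have hq2 : 0 ≤ q + 2 := by linarith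
  have hq3 : 0 ≤ q + 2 + 1 := by linarith
  have hT : 0 < T := hs.1.trans hs.2
  obtain ⟨D₁, hD₁, hD₁b⟩ := hP.exists_energy_dissipation hq
  obtain ⟨D₂, hD₂, hD₂b⟩ := hP.exists_energy_dissipation hq2
  obtain ⟨A₀, hA₀, hA₀b⟩ := hP.exists_integral_sq_bound hq
  obtain ⟨A₁, hA₁, hA₁b⟩ := hP.exists_integral_sq_bound hq1
  obtain ⟨A₂, hA₂, hA₂b⟩ := hP.exists_integral_sq_bound hq2
  obtain ⟨A₃, hA₃, hA₃b⟩ := hP.exists_integral_sq_bound hq3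
  obtain ⟨c, hc0, hcb⟩ := hP.exists_cutoff_dissipation hσ hq
  set Λ := (1 + T * c) / σ ^ 2 with hΛ
  have hΛ0 : 0 ≤ Λ := by positivity
  have hΛσ : Λ * σ ^ 2 = 1 + T * c := div_mul_cancel₀ _ (by positivity)
  set E := T * c * (A₁ + A₃) + Λ * (D₁ + D₂) with hE
  have hE0 : 0 ≤ E := by positivity
  refine ⟨E * T + Λ * (A₀ + A₂) + 1, by positivity, fun t ht L hL => ?_⟩
  have hLne : L ≠ 0 := hL.ne'
  set w : ℝ → ℝ := fun r => r ^ (q + 2) * (1 - r / L) ^ 2 with hw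
  set w' : ℝ → ℝ := fun r => r ^ (q + 1) *
    ((1 - r / L) * ((q + 2) * (1 - r / L) - 2 * (r / L))) with hw'
  have hwd : ∀ r ∈ Icc 0 L, HasDerivAt w (w' r) r := fun r hr =>
    hasDerivAt_rpow_mul_cutoff hq hr.1
  have hw'c : ContinuousOn w' (Icc 0 L) := by
    have := continuous_rpow_const hq1
    exact Continuous.continuousOn (by fun_prop)
  have hw0 : w 0 = 0 := by simp [hw, zero_rpow (by linarith : q + 2 ≠ 0)]
  have hwL : w L = 0 := by simp [hw, hLne]
  set G : ℝ → ℝ := fun t => ∫ r in 0..L, w r * pR P t r ^ 2 with hG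
  set F : ℝ → ℝ := fun t => (t - s) * G t +
    Λ * ((∫ r in 0..L, r ^ q * P t r ^ 2) + ∫ r in 0..L, r ^ (q + 2) * P t r ^ 2) with hF
  have hderiv : ∀ τ ∈ Ioo 0 T, HasDerivAt F (G τ + (τ - s) *
      (∫ r in 0..L, -2 * pTau P τ r * (w r * pRR P τ r + w' r * pR P τ r)) +
      Λ * ((∫ r in 0..L, r ^ q * (2 * P τ r * pTau P τ r)) +
        ∫ r in 0..L, r ^ (q + 2) * (2 * P τ r * pTau P τ r))) τ := by
    intro τ hτ
    have h1 := hP.hasDerivAt_integral_mul_pR_sq hτ hL.le hwd hw'c hw0 hwL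
    have h2 := (hP.hasDerivAt_integral_sq hτ hq hL.le).fun_add
      (hP.hasDerivAt_integral_sq hτ hq2 hL.le)
    refine ((((hasDerivAt_id τ).sub_const s).fun_mul h1).fun_add
      (h2.const_mul Λ)).congr_deriv ?_
    simp [hG]
  have hle : ∀ τ ∈ Ioo s T, G τ + (τ - s) *
      (∫ r in 0..L, -2 * pTau P τ r * (w r * pRR P τ r + w' r * pR P τ r)) +
      Λ * ((∫ r in 0..L, r ^ q * (2 * P τ r * pTau P τ r)) +
        ∫ r in 0..L, r ^ (q + 2) * (2 * P τ r * pTau P τ r)) ≤ E := by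
    intro τ hτs
    have hτ : τ ∈ Ioo 0 T := ⟨hs.1.trans hτs.1, hτs.2⟩
    set J := (∫ r in 0..L, r ^ (q + 1) * pR P τ r ^ 2) +
      ∫ r in 0..L, r ^ (q + 2 + 1) * pR P τ r ^ 2 with hJ
    set R := (∫ r in 0..L, r ^ (q + 1) * P τ r ^ 2) +
      ∫ r in 0..L, r ^ (q + 2 + 1) * P τ r ^ 2 with hR
    have hJ0 : 0 ≤ J := add_nonneg (integral_rpow_mul_sq_nonneg _ hL.le _)
      (integral_rpow_mul_sq_nonneg _ hL.le _)
    have hRle : R ≤ A₁ + A₃ := add_le_add (hA₁b τ hτ L hL) (hA₃b τ hτ L hL)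
    have hR0 : 0 ≤ R := add_nonneg (integral_rpow_mul_sq_nonneg _ hL.le _)
      (integral_rpow_mul_sq_nonneg _ hL.le _)
    have hGJ : G τ ≤ J := hP.integral_cutoff_mul_pR_sq_le hq hτ hL
    have hG' : ∫ r in 0..L, -2 * pTau P τ r * (w r * pRR P τ r + w' r * pR P τ r) ≤
        c * (J + R) := hcb τ hτ L hL
    have h1 := hD₁b τ hτ L hL
    have h2 := hD₂b τ hτ L hL
    have h3 : Λ * ((∫ r in 0..L, r ^ q * (2 * P τ r * pTau P τ r)) +
        ∫ r in 0..L, r ^ (q + 2) * (2 * P τ r * pTau P τ r)) ≤ Λ * (D₁ + D₂ - σ ^ 2 * J) :=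
      mul_le_mul_of_nonneg_left (by linarith) hΛ0
    have h4 : (τ - s) *
        (∫ r in 0..L, -2 * pTau P τ r * (w r * pRR P τ r + w' r * pR P τ r)) ≤
        T * (c * (J + (A₁ + A₃))) := by
      refine (mul_le_mul_of_nonneg_left hG' (by linarith [hτs.1])).trans ?_
      have hτT : τ - s ≤ T := by linarith [hτs.2, hs.1]
      gcongr
    have h5 : Λ * (D₁ + D₂ - σ ^ 2 * J) = Λ * (D₁ + D₂) - (1 + T * c) * J := by
      rw [← hΛσ]
      ring
    rw [hE]
    linarith
  have hIcc : ∀ x ∈ Icc s t, x ∈ Ioo 0 T := fun x hx =>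
    ⟨hs.1.trans_le hx.1, hx.2.trans_lt ht.2⟩
  have hmono := (convex_Icc s t).image_sub_le_mul_sub_of_deriv_le (f := F)
    (fun x hx => (hderiv x (hIcc x hx)).continuousAt.continuousWithinAt)
    (fun x hx => (hderiv x (hIcc x (interior_subset hx))).differentiableAt.differentiableWithinAt)
    (C := E) (fun x hx => by
      rw [(hderiv x (hIcc x (interior_subset hx))).deriv]
      rw [interior_Icc] at hx
      exact hle x ⟨hx.1, hx.2.trans ht.2⟩)
    s (left_mem_Icc.2 ht.1.le) t (right_mem_Icc.2 ht.1.le) ht.1.le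
  have hFs : F s ≤ Λ * (A₀ + A₂) := by
    simp only [hF, sub_self, zero_mul, zero_add]
    exact mul_le_mul_of_nonneg_left (add_le_add (hA₀b s hs L hL) (hA₂b s hs L hL)) hΛ0
  have hFt : (t - s) * G t ≤ F t := le_add_of_nonneg_right (mul_nonneg hΛ0
    (add_nonneg (integral_rpow_mul_sq_nonneg _ hL.le _) (integral_rpow_mul_sq_nonneg _ hL.le _)))
  have hET : E * (t - s) ≤ E * T :=
    mul_le_mul_of_nonneg_left (by linarith [ht.2, hs.1]) hE0
  change (t - s) * G t ≤ _
  linarith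

theorem exists_gradient_moment_bound (hσ : 0 < σ) (hP : IsCompleteSolution σ α β (1 / 2) T P)
    {q : ℝ} (hq : 0 ≤ q) {s : ℝ} (hs : s ∈ Ioo 0 T) :
    ∃ C : ℝ, 0 < C ∧ ∀ t ∈ Ioo s T, ∀ L : ℝ, 0 < L →
      (t - s) * (∫ r in 0..L, r ^ (q + 2) * pR P t r ^ 2) ≤ C := by
  obtain ⟨C, hC, h⟩ := hP.exists_cutoff_gradient_bound hσ hq hs
  refine ⟨4 * C, by positivity, fun t ht L hL => ?_⟩
  have hc : ContinuousOn (pR P t) (Ici 0) := hP.continuousOn_pR ⟨hs.1.trans ht.1, ht.2⟩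
  have hq2 : 0 ≤ q + 2 := by linarith
  have hi : ∀ a b : ℝ, 0 ≤ a → a ≤ b → IntervalIntegrable
      (fun r => r ^ (q + 2) * (1 - r / (2 * L)) ^ 2 * pR P t r ^ 2) volume a b :=
    fun a b ha hab => ContinuousOn.intervalIntegrable_of_Icc hab (by
      have h1 := continuous_rpow_const hq2
      have h2 : ContinuousOn (pR P t) (Icc a b) := hc.mono fun x hx => ha.trans hx.1
      fun_prop)
  have hle : ∫ r in 0..L, r ^ (q + 2) * pR P t r ^ 2 ≤
      4 * ∫ r in 0..2 * L, r ^ (q + 2) * (1 - r / (2 * L)) ^ 2 * pR P t r ^ 2 := by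
    rw [← intervalIntegral.integral_add_adjacent_intervals (hi 0 L le_rfl hL.le)
      (hi L (2 * L) hL.le (by linarith)), mul_add, ← intervalIntegral.integral_const_mul]
    refine le_add_of_le_of_nonneg (intervalIntegral.integral_mono_on hL.le
      (intervalIntegrable_rpow_mul hq2 hL.le (hc.pow 2)) ((hi 0 L le_rfl hL.le).const_mul 4)
      fun r hr => ?_) (mul_nonneg zero_le_four (intervalIntegral.integral_nonneg (by linarith)
        fun r hr => ?_))
    · have h1 : 1 / 2 ≤ 1 - r / (2 * L) := by
        have : r / (2 * L) ≤ 1 / 2 := by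
          rw [div_le_div_iff₀ (by positivity) two_pos]
          linarith [hr.2]
        linarith
      have h2 : 1 ≤ 4 * (1 - r / (2 * L)) ^ 2 := by nlinarith
      have h3 : 0 ≤ r ^ (q + 2) * pR P t r ^ 2 :=
        mul_nonneg (rpow_nonneg hr.1 _) (sq_nonneg _)
      have := mul_le_mul_of_nonneg_left h2 h3
      linarith
    · exact mul_nonneg (mul_nonneg (rpow_nonneg (hL.le.trans hr.1) _) (sq_nonneg _))
        (sq_nonneg _)
  have := mul_le_mul_of_nonneg_left hle (sub_nonneg.2 ht.1.le)
  have := h t ht (2 * L) (by positivity)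
  linarith

end Gradient

end IsCompleteSolution

/-- CIR model with `2α > σ²`. With `ω = 2α/σ² - 1 > 0`, any complete
solution satisfies `d/dτ ∫₀^∞ r^ω P² ≤ K ∫₀^∞ r^ω P²` with `K = -(ω+1)β`. -/
theorem energy_inequality_CIR_strict (σ α β T : ℝ) (hσ : 0 < σ) (hα : 0 < α)
    (hT : 0 < T) (h2α : 2*α > σ^2)
    (ω : ℝ) (hωdef : ω = 2*α/σ^2 - 1) (hωpos : 0 < ω)
    (P : ℝ → ℝ → ℝ) (hP : IsCompleteSolution σ α β (1/2) T P) :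
    ∀ τ ∈ Ioo (0:ℝ) T, ∃ D : ℝ,
      HasDerivAt (fun t => ∫ r in Ioi (0:ℝ), r ^ ω * (P t r)^2) D τ ∧
      D ≤ (-(ω + 1)*β) * ∫ r in Ioi (0:ℝ), r ^ ω * (P τ r)^2 := by
  intro τ hτ
  have hω1 : 0 ≤ ω + 1 := by linarith
  have hω2 : 0 ≤ ω + 2 := by linarith
  have hcancel : 2 * α - σ ^ 2 * (ω + 1) = 0 := by
    rw [hωdef]
    field_simp
    ring
  obtain ⟨A, hA, hAb⟩ := hP.exists_integral_sq_bound hω1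
  obtain ⟨A', hA', hAb'⟩ := hP.exists_integral_sq_bound hω2
  obtain ⟨B, hB, hBb⟩ := hP.exists_boundary_bound hω1
  obtain ⟨C, hC, hCb⟩ := hP.exists_gradient_moment_bound hσ hωpos.le
    (s := τ / 2) ⟨by linarith [hτ.1], by linarith [hτ.1, hτ.2]⟩
  have hτ0 : 0 < τ := hτ.1
  have hU : ∀ t ∈ Ioo (3 * τ / 4) T, t ∈ Ioo 0 T := fun t ht => ⟨by linarith [ht.1], ht.2⟩
  have hgrad : ∀ t ∈ Ioo (3 * τ / 4) T, ∀ L : ℝ, 0 < L →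
      ∫ r in 0..L, r ^ (ω + 2) * pR P t r ^ 2 ≤ C / (τ / 4) := by
    intro t ht L hL
    have h1 := hCb t ⟨by linarith [ht.1], ht.2⟩ L hL
    have h2 := IsCompleteSolution.integral_rpow_mul_sq_nonneg (ω + 2) hL.le (pR P t)
    rw [le_div_iff₀ (by positivity), mul_comm]
    exact (mul_le_mul_of_nonneg_right (by linarith [ht.1]) h2).trans h1
  set C' := 2 * A' + σ ^ 2 * (C / (τ / 4)) with hC'
  have hmass : ∀ t ∈ Ioo (3 * τ / 4) T, IntegrableOn (fun r => r ^ ω * P t r ^ 2) (Ioi 0) ∧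
      ∀ L : ℝ, 0 < L → |(∫ r in Ioi (0:ℝ), r ^ ω * P t r ^ 2) -
        ∫ r in 0..L, r ^ ω * P t r ^ 2| ≤ A / L := by
    intro t ht
    have c0 := hP.continuousOn_slice (hU t ht)
    refine integrableOn_Ioi_of_moment_le
      ((continuous_rpow_const hωpos.le).continuousOn.mul (c0.pow 2))
      (fun r hr => mul_nonneg (rpow_nonneg hr.le _) (sq_nonneg _)) fun L hL => ?_
    refine le_of_eq_of_le (intervalIntegral.integral_congr_uIoo fun r hr => ?_)
      (hAb t (hU t ht) L hL)
    rw [uIoo_of_le hL.le] at hr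
    simp only [rpow_add_one hr.1.ne']
    ring
  have hdiss : ∀ t ∈ Ioo (3 * τ / 4) T,
      IntegrableOn (fun r => r ^ (ω + 1) * (2 * P t r ^ 2 + σ ^ 2 * pR P t r ^ 2)) (Ioi 0) ∧
      ∀ L : ℝ, 0 < L →
        |(∫ r in Ioi (0:ℝ), r ^ (ω + 1) * (2 * P t r ^ 2 + σ ^ 2 * pR P t r ^ 2)) -
          ∫ r in 0..L, r ^ (ω + 1) * (2 * P t r ^ 2 + σ ^ 2 * pR P t r ^ 2)| ≤ C' / L := by
    intro t ht
    have c0 := hP.continuousOn_slice (hU t ht)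
    have c1 := hP.continuousOn_pR (hU t ht)
    refine integrableOn_Ioi_of_moment_le
      ((continuous_rpow_const hω1).continuousOn.mul (by fun_prop))
      (fun r hr => mul_nonneg (rpow_nonneg hr.le _) (by positivity)) fun L hL => ?_
    have i0 : IntervalIntegrable (fun r => r ^ (ω + 2) * P t r ^ 2) volume 0 L :=
      IsCompleteSolution.intervalIntegrable_rpow_mul hω2 hL.le (c0.pow 2)
    have i1 : IntervalIntegrable (fun r => r ^ (ω + 2) * pR P t r ^ 2) volume 0 L :=
      IsCompleteSolution.intervalIntegrable_rpow_mul hω2 hL.le (c1.pow 2)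
    have heq : ∫ r in 0..L, r * (r ^ (ω + 1) * (2 * P t r ^ 2 + σ ^ 2 * pR P t r ^ 2)) =
        2 * (∫ r in 0..L, r ^ (ω + 2) * P t r ^ 2) +
          σ ^ 2 * ∫ r in 0..L, r ^ (ω + 2) * pR P t r ^ 2 := by
      rw [← intervalIntegral.integral_const_mul, ← intervalIntegral.integral_const_mul,
        ← intervalIntegral.integral_add (i0.const_mul _) (i1.const_mul _)]
      refine intervalIntegral.integral_congr_uIoo fun r hr => ?_
      rw [uIoo_of_le hL.le] at hr
      simp only [IsCompleteSolution.rpow_add_two_eq hωpos.le hr.1.le]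
      ring
    rw [heq]
    exact add_le_add (mul_le_mul_of_nonneg_left (hAb' t (hU t ht) L hL) zero_le_two)
      (mul_le_mul_of_nonneg_left (hgrad t ht L hL) (sq_nonneg σ))
  have hτU : τ ∈ Ioo (3 * τ / 4) T := ⟨by linarith, hτ.2⟩
  refine ⟨-(ω + 1) * β * (∫ r in Ioi (0:ℝ), r ^ ω * P τ r ^ 2) -
    ∫ r in Ioi (0:ℝ), r ^ (ω + 1) * (2 * P τ r ^ 2 + σ ^ 2 * pR P τ r ^ 2), ?_,
    sub_le_self _ (setIntegral_nonneg measurableSet_Ioi fun r hr =>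
      mul_nonneg (rpow_nonneg (le_of_lt hr) _) (by positivity))⟩
  refine hasDerivAt_of_tendstoUniformlyOn (l := atTop) (s := Ioo (3 * τ / 4) T)
    (f := fun L t => ∫ r in 0..L, r ^ ω * P t r ^ 2)
    (f' := fun L t => ∫ r in 0..L, r ^ ω * (2 * P t r * pTau P t r))
    (g' := fun t => -(ω + 1) * β * (∫ r in Ioi (0:ℝ), r ^ ω * P t r ^ 2) -
      ∫ r in Ioi (0:ℝ), r ^ (ω + 1) * (2 * P t r ^ 2 + σ ^ 2 * pR P t r ^ 2))
    isOpen_Ioo ?_ ?_ ?_ hτU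
  · rw [Metric.tendstoUniformlyOn_iff]
    intro ε hε
    have hlim : Tendsto (fun L : ℝ => (B + |(ω + 1) * β| * A + C') / L) atTop (𝓝 0) :=
      tendsto_const_nhds.div_atTop tendsto_id
    filter_upwards [hlim.eventually_lt_const hε, eventually_gt_atTop 0] with L hLε hL t ht
    refine lt_of_le_of_lt ?_ hLε
    have h1 := (hmass t ht).2 L hL
    have h2 := (hdiss t ht).2 L hL
    have h3 : |L ^ (ω + 1) * (σ ^ 2 * (P t L * pR P t L) + β * P t L ^ 2)| ≤ B / L := by
      refine (hBb t (hU t ht) L hL).trans ?_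
      rw [div_eq_mul_inv]
      refine mul_le_mul_of_nonneg_left (inv_anti₀ hL ?_) hB.le
      nlinarith [sq_nonneg (L - 1)]
    rw [hP.integral_rpow_mul_pTau (hU t ht) hωpos.le hL.le, hcancel, zero_mul, add_zero,
      Real.dist_eq]
    set I := ∫ r in Ioi (0:ℝ), r ^ ω * P t r ^ 2
    set I' := ∫ r in 0..L, r ^ ω * P t r ^ 2
    set J := ∫ r in Ioi (0:ℝ), r ^ (ω + 1) * (2 * P t r ^ 2 + σ ^ 2 * pR P t r ^ 2)
    set J' := ∫ r in 0..L, r ^ (ω + 1) * (2 * P t r ^ 2 + σ ^ 2 * pR P t r ^ 2)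
    set b := L ^ (ω + 1) * (σ ^ 2 * (P t L * pR P t L) + β * P t L ^ 2)
    calc |-(ω + 1) * β * I - J - (b - (ω + 1) * β * I' - J')|
        = |b + ((ω + 1) * β * (I - I') + (J - J'))| := by
          rw [← abs_neg]
          ring_nf
      _ ≤ |b| + (|(ω + 1) * β * (I - I')| + |J - J'|) :=
          (abs_add_le _ _).trans (add_le_add le_rfl (abs_add_le _ _))
      _ ≤ B / L + (|(ω + 1) * β| * (A / L) + C' / L) := by
          rw [abs_mul ((ω + 1) * β)]
          gcongr
      _ = (B + |(ω + 1) * β| * A + C') / L := by ring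
  · filter_upwards [eventually_ge_atTop 0] with L hL t ht
    exact hP.hasDerivAt_integral_sq (hU t ht) hωpos.le hL
  · intro t ht
    exact intervalIntegral_tendsto_integral_Ioi 0 (hmass t ht).1 tendsto_id
end
end
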